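/- arXiv:1505.03464 — 2 statements merged into one kernel-verified Lean document; each statement's English description precedes it below -/
import Mathlib

section
/- On ℝ², let X₁ = Y₁ = y ∂/∂x, X₂ = Y₂ = ∂/∂y, X₃ = e^{-1/|x|} ∂/∂x and Y₃ = sgn(x) e^{-1/|x|} ∂/∂x (extended by 0 at x=0). Then Σ_{ℓ=1}^3 X_ℓ ⊗ X_ℓ = Σ_{ℓ=1}^3 Y_ℓ ⊗ Y_ℓ, but there is no smooth function g on ℝ² with Y₃ = Σ_ℓ g_ℓ X_ℓ for smooth g₁,g₂,g₃; hence (X₁,X₂,X₃) and (Y₁,Y₂,Y₃) are inequivalent sub-Riemannian structures for the same diffusivity. -/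
noncomputable section

/-- `X₁ = Y₁ = y ∂/∂x`. -/
def X1 : ℝ × ℝ → ℝ × ℝ := fun p => (p.2, 0)

/-- `X₂ = Y₂ = ∂/∂y`. -/
def X2 : ℝ × ℝ → ℝ × ℝ := fun _ => (0, 1)

/-- `X₃ = e^{-1/|x|} ∂/∂x`, extended by `0` at `x = 0`. -/
def X3 : ℝ × ℝ → ℝ × ℝ :=
  fun p => (if p.1 = 0 then 0 else Real.exp (-(1 / |p.1|)), 0)

/-- `Y₃ = sgn(x) e^{-1/|x|} ∂/∂x`, extended by `0` at `x = 0`. -/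
def Y3 : ℝ × ℝ → ℝ × ℝ :=
  fun p => (if p.1 = 0 then 0 else Real.sign p.1 * Real.exp (-(1 / |p.1|)), 0)

theorem X3_eq : X3 = fun p => (expNegInvGlue p.1 + expNegInvGlue (-p.1), 0) := by
  funext p
  rcases lt_trichotomy p.1 0 with h | h | h
  · simp [X3, expNegInvGlue, h.ne, h.le, not_le.mpr h, abs_of_neg h]
  · simp [X3, expNegInvGlue, h]
  · simp [X3, expNegInvGlue, h.ne', h.le, not_le.mpr h, abs_of_pos h]

theorem Y3_eq : Y3 = fun p => (expNegInvGlue p.1 - expNegInvGlue (-p.1), 0) := by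
  funext p
  rcases lt_trichotomy p.1 0 with h | h | h
  · simp [Y3, expNegInvGlue, h.ne, h.le, not_le.mpr h, abs_of_neg h, Real.sign_of_neg h]
  · simp [Y3, expNegInvGlue, h]
  · simp [Y3, expNegInvGlue, h.ne', h.le, not_le.mpr h, abs_of_pos h, Real.sign_of_pos h]

/-- The two families `(X₁,X₂,X₃)` and `(Y₁,Y₂,Y₃) = (X₁,X₂,Y₃)` of smooth vector fields
on `ℝ²` define the same diffusivity `Σ_ℓ X_ℓ ⊗ X_ℓ = Σ_ℓ Y_ℓ ⊗ Y_ℓ` (as quadratic forms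
on covectors `(a,b)`), yet `Y₃` is not a smooth-function combination of `X₁, X₂, X₃`:
the two sub-Riemannian structures are inequivalent. -/
theorem inequivalent_subriemannian_structures :
    (ContDiff ℝ (⊤ : ℕ∞) X3 ∧ ContDiff ℝ (⊤ : ℕ∞) Y3) ∧
    (∀ (p : ℝ × ℝ) (a b : ℝ),
      (a * (X1 p).1 + b * (X1 p).2) ^ 2 + (a * (X2 p).1 + b * (X2 p).2) ^ 2
          + (a * (X3 p).1 + b * (X3 p).2) ^ 2
        = (a * (X1 p).1 + b * (X1 p).2) ^ 2 + (a * (X2 p).1 + b * (X2 p).2) ^ 2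
          + (a * (Y3 p).1 + b * (Y3 p).2) ^ 2) ∧
    ¬ ∃ g₁ g₂ g₃ : ℝ × ℝ → ℝ,
        ContDiff ℝ (⊤ : ℕ∞) g₁ ∧ ContDiff ℝ (⊤ : ℕ∞) g₂ ∧ ContDiff ℝ (⊤ : ℕ∞) g₃ ∧
        ∀ p : ℝ × ℝ, Y3 p = g₁ p • X1 p + g₂ p • X2 p + g₃ p • X3 p := by
  refine ⟨⟨?_, ?_⟩, ?_, ?_⟩
  · rw [X3_eq]
    exact ((expNegInvGlue.contDiff.comp contDiff_fst).add
      (expNegInvGlue.contDiff.comp contDiff_fst.neg)).prodMk contDiff_const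
  · rw [Y3_eq]
    exact ((expNegInvGlue.contDiff.comp contDiff_fst).sub
      (expNegInvGlue.contDiff.comp contDiff_fst.neg)).prodMk contDiff_const
  · intro p a b
    rcases lt_trichotomy p.1 0 with h | h | h
    · simp [X3, Y3, h.ne, Real.sign_of_neg h]
    · simp [X3, Y3, h]
    · simp [X3, Y3, h.ne', Real.sign_of_pos h]
  · rintro ⟨g₁, g₂, g₃, -, -, h3, H⟩
    have key : ∀ x : ℝ, x ≠ 0 → g₃ (x, 0) = Real.sign x := by
      intro x hx
      have h := congrArg Prod.fst (H (x, 0))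
      simp [X1, X2, X3, Y3, hx] at h
      exact h.symm
    have hc : Continuous fun x : ℝ => g₃ (x, 0) :=
      h3.continuous.comp (by fun_prop)
    have hp : Filter.Tendsto (fun x : ℝ => g₃ (x, 0)) (nhdsWithin 0 (Set.Ioi 0)) (nhds 1) := by
      refine tendsto_const_nhds.congr' ?_
      filter_upwards [self_mem_nhdsWithin] with x hx
      rw [key x (ne_of_gt hx), Real.sign_of_pos hx]
    have hn : Filter.Tendsto (fun x : ℝ => g₃ (x, 0)) (nhdsWithin 0 (Set.Iio 0))
        (nhds (-1)) := by
      refine tendsto_const_nhds.congr' ?_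
      filter_upwards [self_mem_nhdsWithin] with x hx
      rw [key x (ne_of_lt hx), Real.sign_of_neg hx]
    have e1 := tendsto_nhds_unique hp ((hc.tendsto 0).mono_left nhdsWithin_le_nhds)
    have e2 := tendsto_nhds_unique hn ((hc.tendsto 0).mono_left nhdsWithin_le_nhds)
    linarith

end
end

section
/- Let Q be a continuous positive-semidefinite quadratic form on a Hilbert space H given by Q(v) = ‖v‖² − ∫_0^1 ⟨v_t, R_t v_t⟩ dt, where H is the space of absolutely continuous paths v: [0,1] → ℝ^d with v_0 = v_1 = 0 and ‖v‖² = ∫_0^1|v̇_t|² dt, and R_t is a continuous symmetric-matrix curve. If there exists a C¹ curve B_t of matrices on (0,1] solving the Riccati equation Ḃ_t + B_t² + R_t = 0 with t B_t → I as t → 0, then Q(v) = ∫_0^1 |v̇_t − B_t v_t|² dt ≥ 0 for all v ∈ H; in particular Q is positive-definite if additionally v̇_t = B_t v_t with v_0 = 0 forces v = 0. -/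
open Set MeasureTheory intervalIntegral Matrix Filter Topology


lemma rq_bound (d : ℕ) (M : ℝ) (E : Matrix (Fin d) (Fin d) ℝ)
    (hE : ∀ i j, |E i j| ≤ M) (x : Fin d → ℝ) :
    |∑ i, ∑ j, E i j * x i * x j| ≤ M * d * ∑ i, x i ^ 2 := by
  have h1 : |∑ i, ∑ j, E i j * x i * x j| ≤ ∑ i, ∑ j, M * ((x i ^ 2 + x j ^ 2) / 2) := by
    refine (Finset.abs_sum_le_sum_abs _ _).trans (Finset.sum_le_sum fun i _ => ?_)
    refine (Finset.abs_sum_le_sum_abs _ _).trans (Finset.sum_le_sum fun j _ => ?_)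
    have hM : 0 ≤ M := (abs_nonneg _).trans (hE i j)
    rw [mul_assoc, abs_mul]
    refine mul_le_mul (hE i j) ?_ (abs_nonneg _) hM
    rw [abs_le]
    constructor <;> nlinarith [sq_nonneg (x i - x j), sq_nonneg (x i + x j)]
  refine h1.trans (le_of_eq ?_)
  simp only [← Finset.mul_sum, ← Finset.sum_div, Finset.sum_add_distrib, Finset.sum_const,
    Finset.card_univ, Fintype.card_fin, nsmul_eq_mul]
  ring

lemma anti_bound (d : ℕ) (M : ℝ) (E A : Matrix (Fin d) (Fin d) ℝ)
    (hE : ∀ i j, |E i j| ≤ M) :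
    |∑ i, ∑ j, A i j * (E * A + A * E) i j| ≤ 2 * M * d * ∑ i, ∑ j, A i j ^ 2 := by
  have h1 : ∑ i, ∑ j, A i j * (E * A + A * E) i j
      = (∑ j, ∑ i, ∑ k, E i k * A i j * A k j) + ∑ i, ∑ k, ∑ j, E k j * A i k * A i j := by
    simp only [Matrix.add_apply, Matrix.mul_apply, mul_add, Finset.sum_add_distrib,
      Finset.mul_sum]
    congr 1
    · rw [Finset.sum_comm]
      refine Finset.sum_congr rfl fun i _ => Finset.sum_congr rfl fun j _ =>
        Finset.sum_congr rfl fun k _ => by ring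
    · refine Finset.sum_congr rfl fun i _ => ?_
      rw [Finset.sum_comm]
      refine Finset.sum_congr rfl fun j _ =>
        Finset.sum_congr rfl fun k _ => by ring
  rw [h1]
  have h2 : |∑ j, ∑ i, ∑ k, E i k * A i j * A k j| ≤ M * d * ∑ i, ∑ j, A i j ^ 2 := by
    refine (Finset.abs_sum_le_sum_abs _ _).trans ?_
    rw [Finset.sum_comm (f := fun i j => A i j ^ 2), Finset.mul_sum]
    exact Finset.sum_le_sum fun j _ => rq_bound d M E hE (fun i => A i j)
  have h3 : |∑ i, ∑ k, ∑ j, E k j * A i k * A i j| ≤ M * d * ∑ i, ∑ j, A i j ^ 2 := by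
    refine (Finset.abs_sum_le_sum_abs _ _).trans ?_
    rw [Finset.mul_sum]
    exact Finset.sum_le_sum fun j _ => rq_bound d M E hE (fun i => A j i)
  refine (abs_add_le _ _).trans ?_
  linarith

lemma riccati_symm (d : ℕ) (R B B' : ℝ → Matrix (Fin d) (Fin d) ℝ)
    (hRsymm : ∀ t, (R t).IsSymm)
    (hB' : ∀ t ∈ Ioc (0:ℝ) 1, ∀ i j, HasDerivAt (fun s => B s i j) (B' t i j) t)
    (hRic : ∀ t ∈ Ioc (0:ℝ) 1, B' t + B t * B t + R t = 0)
    (hBlim : ∀ i j, Tendsto (fun t => t * B t i j) (𝓝[>] (0:ℝ))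
      (𝓝 ((1 : Matrix (Fin d) (Fin d) ℝ) i j))) :
    ∀ t ∈ Ioc (0:ℝ) 1, ∀ i j, B t i j = B t j i := by
  set A : ℝ → Matrix (Fin d) (Fin d) ℝ := fun t => B t - (B t)ᵀ with hA
  set S : ℝ → Matrix (Fin d) (Fin d) ℝ := fun t => B t + (B t)ᵀ with hS
  set g : ℝ → ℝ := fun t => ∑ i, ∑ j, A t i j ^ 2 with hg
  set g' : ℝ → ℝ := fun t => - ∑ i, ∑ j, A t i j * (S t * A t + A t * S t) i j with hg'
  have hg0 : ∀ t, 0 ≤ g t := fun t => by positivity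
  have hder : ∀ t ∈ Ioc (0:ℝ) 1, HasDerivAt g (g' t) t := by
    intro t ht
    have hAd : ∀ i j, HasDerivAt (fun s => A s i j) (B' t i j - B' t j i) t := fun i j =>
      (hB' t ht i j).sub (hB' t ht j i)
    have : HasDerivAt g (∑ i, ∑ j, 2 * A t i j * (B' t i j - B' t j i)) t := by
      refine HasDerivAt.fun_sum fun i _ => HasDerivAt.fun_sum fun j _ => ?_
      simpa using (hAd i j).fun_pow 2
    convert this using 1
    simp only [hg', ← Finset.sum_neg_distrib]
    refine Finset.sum_congr rfl fun i _ => Finset.sum_congr rfl fun j _ => ?_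
    have hm : S t * A t + A t * S t = (2:ℝ) • (((B t) * B t) - (B t * B t)ᵀ) := by
      simp only [hS, hA, Matrix.transpose_mul]
      rw [two_smul]; noncomm_ring
    have h1 := congrFun (congrFun (hRic t ht) i) j
    have h2 := congrFun (congrFun (hRic t ht) j) i
    have h3 := (hRsymm t).apply i j
    simp only [Matrix.add_apply, Matrix.zero_apply] at h1 h2
    rw [hm]
    simp only [Matrix.smul_apply, Matrix.sub_apply, Matrix.transpose_apply, smul_eq_mul]
    have : B' t i j - B' t j i = - ((B t * B t) i j - (B t * B t) j i) := by linarith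
    rw [this]; ring
  -- near zero
  have hlim0 : Tendsto (fun t => t ^ 2 * g t) (𝓝[>] (0:ℝ)) (𝓝 0) := by
    have h : Tendsto (fun t => ∑ i, ∑ j, (t * B t i j - t * B t j i) ^ 2) (𝓝[>] (0:ℝ))
        (𝓝 (∑ i, ∑ j, ((1 : Matrix (Fin d) (Fin d) ℝ) i j
          - (1 : Matrix (Fin d) (Fin d) ℝ) j i) ^ 2)) :=
      tendsto_finsetSum _ fun i _ => tendsto_finsetSum _ fun j _ =>
        ((hBlim i j).sub (hBlim j i)).pow 2
    have h0 : (∑ i, ∑ j, ((1 : Matrix (Fin d) (Fin d) ℝ) i j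
          - (1 : Matrix (Fin d) (Fin d) ℝ) j i) ^ 2) = 0 := by
      refine Finset.sum_eq_zero fun i _ => Finset.sum_eq_zero fun j _ => ?_
      have := (Matrix.isSymm_one (α := ℝ) (n := Fin d)).apply i j
      rw [this]; simp
    rw [h0] at h
    refine h.congr fun t => ?_
    simp only [hg, Finset.mul_sum, hA, Matrix.sub_apply, Matrix.transpose_apply]
    refine Finset.sum_congr rfl fun i _ => Finset.sum_congr rfl fun j _ => by ring
  have hε : (0:ℝ) < 1 / (d + 1) := by positivity
  have hev : ∀ᶠ t in 𝓝[>] (0:ℝ), ∀ i j,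
      |(t • S t - (2:ℝ) • (1 : Matrix (Fin d) (Fin d) ℝ)) i j| ≤ 1 / (d + 1) := by
    rw [eventually_all]; intro i
    rw [eventually_all]; intro j
    have h := ((hBlim i j).add (hBlim j i)).sub_const (2 * (1 : Matrix (Fin d) (Fin d) ℝ) i j)
    have h1 := (Matrix.isSymm_one (α := ℝ) (n := Fin d)).apply i j
    rw [h1, show ∀ x : ℝ, x + x - 2 * x = 0 by intro x; ring] at h
    have h2 := h.abs
    rw [abs_zero] at h2
    filter_upwards [h2.eventually_le_const hε] with t ht
    simpa [hS, mul_add] using ht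
  obtain ⟨δ, hδ0, hδ⟩ := (mem_nhdsGT_iff_exists_Ioo_subset.mp hev)
  rw [mem_Ioi] at hδ0
  set η := min (δ / 2) 1 with hη
  have hη0 : 0 < η := by positivity
  have hη1 : η ≤ 1 := min_le_right _ _
  have hηδ : η < δ := (min_le_left _ _).trans_lt (by linarith)
  have hsmall : ∀ t ∈ Ioc (0:ℝ) η, t ^ 2 * g t = 0 := by
    have hd2 : ∀ t ∈ Ioc (0:ℝ) η,
        HasDerivAt (fun s => s ^ 2 * g s) (2 * t * g t + t ^ 2 * g' t) t := by
      intro t ht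
      simpa using (hasDerivAt_pow 2 t).fun_mul (hder t ⟨ht.1, ht.2.trans hη1⟩)
    have hanti : AntitoneOn (fun s => s ^ 2 * g s) (Ioc 0 η) := by
      refine antitoneOn_of_deriv_nonpos (convex_Ioc _ _)
        (fun t ht => (hd2 t ht).continuousAt.continuousWithinAt)
        (fun t ht => ((hd2 t (interior_subset ht)).differentiableAt.differentiableWithinAt)) ?_
      intro t ht
      have ht := interior_subset ht
      rw [(hd2 t ht).deriv]
      have hb := anti_bound d _ _ (A t) (hδ (show t ∈ Ioo 0 δ from ⟨ht.1, ht.2.trans_lt hηδ⟩))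
      have he : ∑ i, ∑ j, A t i j * ((t • S t - (2:ℝ) • (1 : Matrix (Fin d) (Fin d) ℝ)) * A t
          + A t * (t • S t - (2:ℝ) • (1 : Matrix (Fin d) (Fin d) ℝ))) i j
          = - (t * g' t) - 4 * g t := by
        have hm : (t • S t - (2:ℝ) • (1 : Matrix (Fin d) (Fin d) ℝ)) * A t
          + A t * (t • S t - (2:ℝ) • (1 : Matrix (Fin d) (Fin d) ℝ))
          = t • (S t * A t + A t * S t) - (4:ℝ) • A t := by
          simp only [sub_mul, mul_sub, smul_mul_assoc, mul_smul_comm, one_mul, mul_one, smul_add]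
          rw [show (4:ℝ) = 2 + 2 by norm_num, add_smul]; abel
        rw [hm]
        simp only [hg', hg, Finset.mul_sum, mul_neg, neg_neg, ← Finset.sum_sub_distrib]
        refine Finset.sum_congr rfl fun i _ => Finset.sum_congr rfl fun j _ => ?_
        simp only [Matrix.sub_apply, Matrix.smul_apply, smul_eq_mul]
        ring
      rw [he] at hb
      have hb' := (abs_le.mp hb).1
      have hfrac : 2 * (1 / ((d:ℝ) + 1)) * d ≤ 2 := by
        rw [mul_assoc, one_div, inv_mul_eq_div]
        have : (d:ℝ) / (d + 1) ≤ 1 := by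
          rw [div_le_one (by positivity)]; linarith
        linarith
      have : 2 * (1 / ((d:ℝ) + 1)) * d * g t ≤ 2 * g t :=
        mul_le_mul_of_nonneg_right hfrac (hg0 t)
      have h5 : 2 * g t + t * g' t ≤ 0 := by
        change -(2 * (1 / ((d:ℝ) + 1)) * d * g t) ≤ _ at hb'
        linarith
      nlinarith [ht.1]
    intro t ht
    refine le_antisymm ?_ (mul_nonneg (sq_nonneg _) (hg0 t))
    refine ge_of_tendsto hlim0 ?_
    filter_upwards [Ioo_mem_nhdsGT ht.1] with s hs
    exact hanti ⟨hs.1, hs.2.le.trans ht.2⟩ ht hs.2.le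
  have hgη : ∀ t ∈ Ioc (0:ℝ) η, g t = 0 := fun t ht =>
    (mul_eq_zero.mp (hsmall t ht)).resolve_left (pow_ne_zero _ ht.1.ne')
  have hgall : ∀ t ∈ Ioc (0:ℝ) 1, g t = 0 := by
    intro t ht
    rcases le_or_gt t η with h | h
    · exact hgη t ⟨ht.1, h⟩
    have hsub : Icc η 1 ⊆ Ioc 0 1 := fun s hs => ⟨hη0.trans_le hs.1, hs.2⟩
    have hSc : ∀ i j, ∃ C, ∀ s ∈ Icc η 1, ‖S s i j‖ ≤ C := fun i j =>
      isCompact_Icc.exists_bound_of_continuousOn fun s hs =>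
        ((hB' s (hsub hs) i j).continuousAt.add
          (hB' s (hsub hs) j i).continuousAt).continuousWithinAt
    choose C hC using hSc
    have hM : ∀ s ∈ Icc η 1, ∀ i j, |S s i j| ≤ ∑ i, ∑ j, |C i j| := by
      intro s hs i j
      refine (hC i j s hs).trans ((le_abs_self _).trans ?_)
      refine le_trans ?_ (Finset.single_le_sum (f := fun i => ∑ j, |C i j|)
        (fun _ _ => by positivity) (Finset.mem_univ i))
      exact (Finset.single_le_sum (f := fun j => |C i j|)
        (fun _ _ => by positivity) (Finset.mem_univ j))
    refine eq_zero_of_abs_deriv_le_mul_abs_self_of_eq_zero_right (f := g) (f' := g')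
      (K := 2 * (∑ i, ∑ j, |C i j|) * d) (a := η) (b := 1) 
      (fun s hs => (hder s (hsub hs)).continuousAt.continuousWithinAt)
      (fun s hs => (hder s (hsub ⟨hs.1, hs.2.le⟩)).hasDerivWithinAt)
      (hgη η ⟨hη0, le_rfl⟩) ?_ t ⟨h.le, ht.2⟩
    intro s hs
    have := anti_bound d _ (S s) (A s) (hM s ⟨hs.1, hs.2.le⟩)
    rw [Real.norm_eq_abs, Real.norm_eq_abs, abs_of_nonneg (hg0 s), hg', abs_neg]
    exact this
  intro t ht i j
  have h := hgall t ht
  have h1 := (Finset.sum_eq_zero_iff_of_nonneg (fun i _ => by positivity)).mp h i (Finset.mem_univ _)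
  have h2 := (Finset.sum_eq_zero_iff_of_nonneg (fun i _ => by positivity)).mp h1 j (Finset.mem_univ _)
  have h3 : A t i j = 0 := by simpa using h2
  simpa [hA, sub_eq_zero] using h3

lemma cs_interval (f : ℝ → ℝ) (t : ℝ) (ht : 0 < t) (hf : IntervalIntegrable f volume 0 t)
    (hf2 : IntervalIntegrable (fun s => f s ^ 2) volume 0 t) :
    (∫ s in (0:ℝ)..t, f s) ^ 2 / t ≤ ∫ s in (0:ℝ)..t, f s ^ 2 := by
  set c := (∫ s in (0:ℝ)..t, f s) / t with hc
  have h0 : 0 ≤ ∫ s in (0:ℝ)..t, (f s - c) ^ 2 :=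
    intervalIntegral.integral_nonneg ht.le fun _ _ => sq_nonneg _
  have h1 : ∫ s in (0:ℝ)..t, (f s - c) ^ 2
      = (∫ s in (0:ℝ)..t, f s ^ 2) - 2 * c * (∫ s in (0:ℝ)..t, f s) + c ^ 2 * t := by
    have : (fun s => (f s - c) ^ 2) = fun s => (f s ^ 2 - 2 * c * f s) + c ^ 2 := by
      funext s; ring
    rw [this, intervalIntegral.integral_add (hf2.sub (hf.const_mul _)) (by simp),
      intervalIntegral.integral_sub hf2 (hf.const_mul _), intervalIntegral.integral_const_mul]
    simp; ring
  have h2 : (∫ s in (0:ℝ)..t, f s) = c * t := by rw [hc]; field_simp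
  rw [h1, h2] at h0
  rw [h2]
  have : (c * t) ^ 2 / t = c ^ 2 * t := by field_simp
  rw [this]; nlinarith

lemma dot_expand (d : ℕ) (M : Matrix (Fin d) (Fin d) ℝ) (x y : Fin d → ℝ) :
    x ⬝ᵥ (M *ᵥ y) = ∑ i, ∑ j, M i j * x i * y j := by
  simp only [dotProduct, Matrix.mulVec, Finset.mul_sum]
  refine Finset.sum_congr rfl fun i _ => Finset.sum_congr rfl fun j _ => by ring

lemma ac_sum {ι : Type*} (s : Finset ι) (f : ι → ℝ → ℝ) (a b : ℝ)
    (h : ∀ i ∈ s, AbsolutelyContinuousOnInterval (f i) a b) :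
    AbsolutelyContinuousOnInterval (fun x => ∑ i ∈ s, f i x) a b := by
  classical
  induction s using Finset.induction_on with
  | empty =>
    simp only [Finset.sum_empty]
    exact (contDiff_const (c := (0:ℝ)).contDiffOn
      (n := 1) (𝕜 := ℝ)).absolutelyContinuousOnInterval
  | insert i s hi ih =>
    simp only [Finset.sum_insert hi]
    exact (h i (Finset.mem_insert_self _ _)).fun_add
      (ih fun j hj => h j (Finset.mem_insert_of_mem hj))

lemma riccati_pointwise (d : ℕ) (R B B' : Matrix (Fin d) (Fin d) ℝ) (hs : ∀ i j, B i j = B j i)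
    (hRic : B' + B * B + R = 0) (x y : Fin d → ℝ) :
    (y - B *ᵥ x) ⬝ᵥ (y - B *ᵥ x) = y ⬝ᵥ y - x ⬝ᵥ (R *ᵥ x)
      - (x ⬝ᵥ (B' *ᵥ x) + y ⬝ᵥ (B *ᵥ x) + x ⬝ᵥ (B *ᵥ y)) := by
  have hT : Bᵀ = B := by ext i j; exact hs j i
  have h1 : B' = - (B * B) - R := by rw [← sub_eq_zero, ← hRic]; abel
  have h2 : ∀ a b : Fin d → ℝ, a ⬝ᵥ (B *ᵥ b) = (B *ᵥ a) ⬝ᵥ b := by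
    intro a b
    rw [Matrix.dotProduct_mulVec, ← Matrix.mulVec_transpose, hT]
  have h3 : x ⬝ᵥ ((B * B) *ᵥ x) = (B *ᵥ x) ⬝ᵥ (B *ᵥ x) := by
    rw [← Matrix.mulVec_mulVec, h2]
  rw [h1, Matrix.sub_mulVec, Matrix.neg_mulVec]
  simp only [dotProduct_sub, sub_dotProduct, dotProduct_neg]
  rw [h3, h2 x y, dotProduct_comm (B *ᵥ x) y]
  ring

/-- Let `Q(v) = ∫_0^1 |v̇|² − ∫_0^1 ⟨v, R v⟩` on `H¹₀([0,1], ℝ^d)` and suppose there is a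
`C¹` matrix curve `B` on `(0,1]` solving the Riccati equation `Ḃ + B² + R = 0` with
`t B_t → I` as `t → 0⁺`.  Then `Q(v) = ∫_0^1 |v̇_t − B_t v_t|² dt ≥ 0` for all `v`; in
particular `Q` is positive-definite if additionally `v̇ = B v`, `v 0 = 0` forces `v = 0`. -/
theorem second_variation_riccati_identity (d : ℕ)
    (R B B' : ℝ → Matrix (Fin d) (Fin d) ℝ)
    (hRcont : ∀ i j, Continuous fun t => R t i j)
    (hRsymm : ∀ t, (R t).IsSymm)
    (hB' : ∀ t ∈ Ioc (0:ℝ) 1, ∀ i j, HasDerivAt (fun s => B s i j) (B' t i j) t)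
    (hRic : ∀ t ∈ Ioc (0:ℝ) 1, B' t + B t * B t + R t = 0)
    (hBlim : ∀ i j, Tendsto (fun t => t * B t i j) (𝓝[>] (0:ℝ))
      (𝓝 ((1 : Matrix (Fin d) (Fin d) ℝ) i j)))
    (v v' : ℝ → (Fin d → ℝ))
    (hv'int : IntervalIntegrable v' volume 0 1)
    (hv'sq : IntervalIntegrable (fun t => v' t ⬝ᵥ v' t) volume 0 1)
    (hv : ∀ t ∈ Icc (0:ℝ) 1, v t = ∫ s in (0:ℝ)..t, v' s)
    (hv1 : v 1 = 0) :
    ((∫ t in (0:ℝ)..1, v' t ⬝ᵥ v' t) - ∫ t in (0:ℝ)..1, v t ⬝ᵥ (R t *ᵥ v t))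
        = ∫ t in (0:ℝ)..1, (v' t - B t *ᵥ v t) ⬝ᵥ (v' t - B t *ᵥ v t) ∧
      0 ≤ (∫ t in (0:ℝ)..1, v' t ⬝ᵥ v' t) - ∫ t in (0:ℝ)..1, v t ⬝ᵥ (R t *ᵥ v t) ∧
      ((∀ w : ℝ → (Fin d → ℝ), Continuous w → w 0 = 0 →
          (∀ t ∈ Ioc (0:ℝ) 1, HasDerivAt w (B t *ᵥ w t) t) →
          ∀ t ∈ Icc (0:ℝ) 1, w t = 0) →
        ((∫ t in (0:ℝ)..1, v' t ⬝ᵥ v' t) - (∫ t in (0:ℝ)..1, v t ⬝ᵥ (R t *ᵥ v t)) = 0 →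
          ∀ t ∈ Icc (0:ℝ) 1, v t = 0)) := by
  have hsym := riccati_symm d R B B' hRsymm hB' hRic hBlim
  have h01 : uIcc (0:ℝ) 1 = Icc 0 1 := uIcc_of_le zero_le_one
  -- coordinates
  have hvi : ∀ i, IntervalIntegrable (fun s => v' s i) volume 0 1 := fun i =>
    ⟨(ContinuousLinearMap.proj (R := ℝ) (φ := fun _ : Fin d => ℝ) i).integrable_comp hv'int.1,
     (ContinuousLinearMap.proj (R := ℝ) (φ := fun _ : Fin d => ℝ) i).integrable_comp hv'int.2⟩
  have hvi2 : ∀ i, IntervalIntegrable (fun s => v' s i ^ 2) volume 0 1 := by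
    intro i
    refine hv'sq.mono_fun ?_ ?_
    · have := (intervalIntegrable_iff.mp (hvi i)).aestronglyMeasurable
      exact this.pow 2
    · refine Eventually.of_forall fun s => ?_
      have h1 : v' s i ^ 2 ≤ v' s ⬝ᵥ v' s := by
        have := Finset.single_le_sum (f := fun i => v' s i * v' s i)
          (fun j _ => mul_self_nonneg _) (Finset.mem_univ i)
        rw [sq]; exact this
      simp only [Real.norm_eq_abs]
      rw [abs_of_nonneg (sq_nonneg _)]
      exact h1.trans (le_abs_self _)
  set u : ℝ → (Fin d → ℝ) := fun t i => ∫ s in (0:ℝ)..t, v' s i with hu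
  have huv : ∀ t ∈ Icc (0:ℝ) 1, v t = u t := by
    intro t ht
    rw [hv t ht]
    ext i
    have hI : IntervalIntegrable v' volume 0 t := hv'int.mono_set (by
      rw [h01, uIcc_of_le ht.1]; exact Icc_subset_Icc_right ht.2)
    have := (ContinuousLinearMap.proj (R := ℝ) (φ := fun _ : Fin d => ℝ) i).intervalIntegral_comp_comm hI
    simpa using this.symm
  have hu1 : u 1 = 0 := by rw [← huv 1 (by simp), hv1]
  have huac : ∀ i, AbsolutelyContinuousOnInterval (fun t => u t i) 0 1 := fun i =>
    (hvi i).absolutelyContinuousOnInterval_intervalIntegral (by simp)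
  have huder : ∀ᵐ t, t ∈ Icc (0:ℝ) 1 → ∀ i, HasDerivAt (fun t => u t i) (v' t i) t := by
    have : ∀ᵐ t, ∀ i, t ∈ uIcc (0:ℝ) 1 → HasDerivAt (fun t => u t i) (v' t i) t := by
      rw [ae_all_iff]; intro i
      filter_upwards [(hvi i).ae_hasDerivAt_integral] with t ht ht'
      exact ht ht' 0 (by simp)
    filter_upwards [this] with t ht ht' i
    exact ht i (by rwa [h01])
  have hucont : ∀ i, ContinuousOn (fun t => u t i) (Icc 0 1) := fun i => by
    have := (huac i).continuousOn
    rwa [h01] at this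
  have hBcont : ∀ i j, ContinuousOn (fun t => B t i j) (Ioc 0 1) := fun i j t ht =>
    (hB' t ht i j).continuousAt.continuousWithinAt
  have hB'cont : ∀ i j, ContinuousOn (fun t => B' t i j) (Ioc 0 1) := by
    intro i j
    have h : ContinuousOn (fun t => - (∑ k, B t i k * B t k j) - R t i j) (Ioc 0 1) :=
      (continuousOn_finsetSum _ fun k _ => (hBcont i k).mul (hBcont k j)).neg.sub
        (hRcont i j).continuousOn
    refine h.congr fun t ht => ?_
    have := congrFun (congrFun (hRic t ht) i) j
    simp only [Matrix.add_apply, Matrix.zero_apply, Matrix.mul_apply] at this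
    linarith
  have hsub : ∀ a, 0 < a → Icc a 1 ⊆ Ioc (0:ℝ) 1 := fun a ha s hs => ⟨ha.trans_le hs.1, hs.2⟩
  have hBac : ∀ a, 0 < a → a ≤ 1 → ∀ i j, AbsolutelyContinuousOnInterval (fun t => B t i j) a 1 := by
    intro a ha ha1 i j
    obtain ⟨C, hC⟩ := isCompact_Icc.exists_bound_of_continuousOn ((hB'cont i j).mono (hsub a ha))
    have : LipschitzOnWith (Real.toNNReal C) (fun t => B t i j) (uIcc a 1) := by
      rw [uIcc_of_le ha1]
      refine (convex_Icc a 1).lipschitzOnWith_of_nnnorm_hasDerivWithin_le (f' := fun t => B' t i j)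
        (fun t ht => (hB' t (hsub a ha ht) i j).hasDerivWithinAt) fun t ht => ?_
      rw [← NNReal.coe_le_coe, coe_nnnorm]
      exact (hC t ht).trans (Real.le_coe_toNNReal C)
    exact this.absolutelyContinuousOnInterval
  have huac' : ∀ a, 0 < a → a ≤ 1 → ∀ i, AbsolutelyContinuousOnInterval (fun t => u t i) a 1 := by
    intro a ha ha1 i
    refine (huac i).mono ?_
    rw [h01, uIcc_of_le ha1]; exact Icc_subset_Icc_left ha.le
  -- the boundary term
  set P : ℝ → ℝ := fun t => ∑ i, ∑ j, B t i j * u t i * u t j with hP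
  set P' : ℝ → ℝ := fun t => u t ⬝ᵥ (B' t *ᵥ u t) + v' t ⬝ᵥ (B t *ᵥ u t) + u t ⬝ᵥ (B t *ᵥ v' t)
    with hP'
  have hPac : ∀ a, 0 < a → a ≤ 1 → AbsolutelyContinuousOnInterval P a 1 := fun a ha ha1 =>
    ac_sum _ _ _ _ fun i _ => ac_sum _ _ _ _ fun j _ =>
      ((hBac a ha ha1 i j).fun_mul (huac' a ha ha1 i)).fun_mul (huac' a ha ha1 j)
  have hPder : ∀ᵐ t, t ∈ Ioc (0:ℝ) 1 → HasDerivAt P (P' t) t := by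
    filter_upwards [huder] with t ht ht'
    have hd := ht ⟨ht'.1.le, ht'.2⟩
    have h : HasDerivAt P (∑ i, ∑ j, ((B' t i j * u t i + B t i j * v' t i) * u t j
        + B t i j * u t i * v' t j)) t :=
      HasDerivAt.fun_sum fun i _ => HasDerivAt.fun_sum fun j _ =>
        ((hB' t ht' i j).fun_mul (hd i)).fun_mul (hd j)
    convert h using 1
    simp only [hP', dot_expand, ← Finset.sum_add_distrib]
    refine Finset.sum_congr rfl fun i _ => Finset.sum_congr rfl fun j _ => by ring
  have hPint : ∀ a, 0 < a → a ≤ 1 → IntervalIntegrable P' volume a 1 ∧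
      ∫ t in a..1, P' t = - P a := by
    intro a ha ha1
    have hae : ∀ᵐ t, t ∈ uIoc a 1 → deriv P t = P' t := by
      filter_upwards [hPder] with t ht ht'
      rw [uIoc_of_le ha1] at ht'
      exact (ht ⟨ha.trans ht'.1, ht'.2⟩).deriv
    constructor
    · refine (hPac a ha ha1).intervalIntegrable_deriv.congr_ae ?_
      exact (ae_restrict_iff' measurableSet_uIoc).mpr hae
    · rw [← intervalIntegral.integral_congr_ae hae, (hPac a ha ha1).integral_deriv_eq_sub]
      simp [hP, hu1]
  have hPlim : Tendsto P (𝓝[>] (0:ℝ)) (𝓝 0) := by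
    have hφ : ∀ i, Tendsto (fun t => ∫ s in (0:ℝ)..t, v' s i ^ 2) (𝓝[>] (0:ℝ)) (𝓝 0) := by
      intro i
      have h := ((hvi2 i).absolutelyContinuousOnInterval_intervalIntegral
        (c := 0) (by simp)).continuousOn
      rw [h01] at h
      have h2 := (h 0 (by simp)).tendsto
      rw [intervalIntegral.integral_same] at h2
      refine h2.mono_left ?_
      rw [← nhdsWithin_Ioc_eq_nhdsGT (zero_lt_one (α := ℝ))]
      exact nhdsWithin_mono _ Ioc_subset_Icc_self
    have hq : ∀ i j, Tendsto (fun t => u t i * u t j / t) (𝓝[>] (0:ℝ)) (𝓝 0) := by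
      intro i j
      have hs : Tendsto (fun t => ((∫ s in (0:ℝ)..t, v' s i ^ 2) + ∫ s in (0:ℝ)..t, v' s j ^ 2))
        (𝓝[>] (0:ℝ)) (𝓝 0) := by simpa using (hφ i).add (hφ j)
      refine squeeze_zero_norm' ?_ hs
      filter_upwards [Ioo_mem_nhdsGT (zero_lt_one (α := ℝ))] with t ht
      have hm : uIcc 0 t ⊆ uIcc (0:ℝ) 1 := by
        rw [h01, uIcc_of_le ht.1.le]; exact Icc_subset_Icc_right ht.2.le
      have h1 := cs_interval _ t ht.1 ((hvi i).mono_set hm) ((hvi2 i).mono_set hm)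
      have h2 := cs_interval _ t ht.1 ((hvi j).mono_set hm) ((hvi2 j).mono_set hm)
      refine le_trans ?_ (add_le_add h1 h2)
      rw [Real.norm_eq_abs, abs_div, abs_of_pos ht.1, ← add_div]
      refine div_le_div_of_nonneg_right ?_ ht.1.le
      change |u t i * u t j| ≤ u t i ^ 2 + u t j ^ 2
      rw [abs_le]
      constructor <;> nlinarith [sq_nonneg (u t i + u t j), sq_nonneg (u t i - u t j)]
    have h : Tendsto (fun t => ∑ i, ∑ j, (t * B t i j) * (u t i * u t j / t)) (𝓝[>] (0:ℝ))
        (𝓝 (∑ i, ∑ j, (1 : Matrix (Fin d) (Fin d) ℝ) i j * 0)) :=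
      tendsto_finsetSum _ fun i _ => tendsto_finsetSum _ fun j _ => (hBlim i j).mul (hq i j)
    simp only [mul_zero, Finset.sum_const_zero] at h
    refine h.congr' ?_
    filter_upwards [self_mem_nhdsWithin] with t ht
    have ht : t ≠ 0 := (mem_Ioi.mp ht).ne'
    simp only [hP]
    refine Finset.sum_congr rfl fun i _ => Finset.sum_congr rfl fun j _ => ?_
    field_simp
  -- replace v by u
  have hRu : (∫ t in (0:ℝ)..1, v t ⬝ᵥ (R t *ᵥ v t)) = ∫ t in (0:ℝ)..1, u t ⬝ᵥ (R t *ᵥ u t) := by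
    refine intervalIntegral.integral_congr fun t ht => ?_
    rw [h01] at ht
    simp only [huv t ht]
  have hFu : (∫ t in (0:ℝ)..1, (v' t - B t *ᵥ v t) ⬝ᵥ (v' t - B t *ᵥ v t))
      = ∫ t in (0:ℝ)..1, (v' t - B t *ᵥ u t) ⬝ᵥ (v' t - B t *ᵥ u t) := by
    refine intervalIntegral.integral_congr fun t ht => ?_
    rw [h01] at ht
    simp only [huv t ht]
  rw [hRu, hFu]
  have hRint : IntervalIntegrable (fun t => u t ⬝ᵥ (R t *ᵥ u t)) volume 0 1 := by
    refine ContinuousOn.intervalIntegrable ?_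
    rw [h01]
    simp only [dot_expand]
    exact continuousOn_finsetSum _ fun i _ => continuousOn_finsetSum _ fun j _ =>
      ((hRcont i j).continuousOn.mul (hucont i)).mul (hucont j)
  set q : ℝ → ℝ := fun t => v' t ⬝ᵥ v' t - u t ⬝ᵥ (R t *ᵥ u t) with hq
  have hqint : IntervalIntegrable q volume 0 1 := hv'sq.sub hRint
  rw [← intervalIntegral.integral_sub hv'sq hRint]
  change (∫ t in (0:ℝ)..1, q t) = _ ∧ 0 ≤ (∫ t in (0:ℝ)..1, q t) ∧
    (_ → (∫ t in (0:ℝ)..1, q t) = 0 → _)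
  set F : ℝ → ℝ := fun t => (v' t - B t *ᵥ u t) ⬝ᵥ (v' t - B t *ᵥ u t) with hF
  have hF0 : ∀ t, 0 ≤ F t := fun t => Finset.sum_nonneg fun i _ => mul_self_nonneg _
  have hFq : ∀ t ∈ Ioc (0:ℝ) 1, F t = q t - P' t := fun t ht =>
    riccati_pointwise d _ _ _ (hsym t ht) (hRic t ht) _ _
  have hqa : ∀ a, 0 < a → a ≤ 1 → IntervalIntegrable q volume a 1 := fun a ha ha1 =>
    hqint.mono_set (by rw [h01, uIcc_of_le ha1]; exact Icc_subset_Icc_left ha.le)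
  have hFa : ∀ a, 0 < a → a ≤ 1 → IntervalIntegrable F volume a 1 ∧
      ∫ t in a..1, F t = (∫ t in a..1, q t) + P a := by
    intro a ha ha1
    have heq : EqOn F (fun t => q t - P' t) (uIoc a 1) := fun t ht => by
      rw [uIoc_of_le ha1] at ht
      exact hFq t ⟨ha.trans ht.1, ht.2⟩
    constructor
    · exact ((hqa a ha ha1).sub (hPint a ha ha1).1).congr heq.symm
    · rw [intervalIntegral.integral_congr_ae (Eventually.of_forall fun t ht => heq ht),
        intervalIntegral.integral_sub (hqa a ha ha1) (hPint a ha ha1).1, (hPint a ha ha1).2]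
      ring
  have hprim : ∀ f : ℝ → ℝ, IntervalIntegrable f volume 0 1 →
      Tendsto (fun a => ∫ t in a..1, f t) (𝓝[>] (0:ℝ)) (𝓝 (∫ t in (0:ℝ)..1, f t)) := by
    intro f hf
    have h := (hf.absolutelyContinuousOnInterval_intervalIntegral
        (c := 1) (by simp)).continuousOn
    rw [h01] at h
    have h2 := (h 0 (by simp)).tendsto.neg
    simp only [← intervalIntegral.integral_symm] at h2
    refine h2.mono_left ?_
    rw [← nhdsWithin_Ioc_eq_nhdsGT (zero_lt_one (α := ℝ))]
    exact nhdsWithin_mono _ Ioc_subset_Icc_self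
  have hlim : Tendsto (fun a => ∫ t in a..1, F t) (𝓝[>] (0:ℝ)) (𝓝 (∫ t in (0:ℝ)..1, q t)) := by
    have h := (hprim q hqint).add hPlim
    rw [add_zero] at h
    refine h.congr' ?_
    filter_upwards [Ioo_mem_nhdsGT (zero_lt_one (α := ℝ))] with a ha
    exact (hFa a ha.1 ha.2.le).2.symm
  have hFint : IntervalIntegrable F volume 0 1 := by
    rw [intervalIntegrable_iff_integrableOn_Ioc_of_le zero_le_one]
    have hseq : Tendsto (fun n : ℕ => 1 / ((n:ℝ) + 1)) atTop (𝓝 0) :=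
      tendsto_one_div_add_atTop_nhds_zero_nat
    have hpos : ∀ n : ℕ, 0 < 1 / ((n:ℝ) + 1) := fun n => by positivity
    have hle : ∀ n : ℕ, 1 / ((n:ℝ) + 1) ≤ 1 := fun n => by
      rw [div_le_one (by positivity)]; linarith [n.cast_nonneg (α := ℝ)]
    have hseq' : Tendsto (fun n : ℕ => 1 / ((n:ℝ) + 1)) atTop (𝓝[>] 0) :=
      tendsto_nhdsWithin_iff.mpr ⟨hseq, Eventually.of_forall hpos⟩
    refine integrableOn_Ioc_of_intervalIntegral_norm_bounded_left
      (I := (∫ t in (0:ℝ)..1, q t) + 1) (l := atTop) (a := fun n : ℕ => 1 / ((n:ℝ) + 1))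
      (fun n => ?_) hseq ?_
    · exact (intervalIntegrable_iff_integrableOn_Ioc_of_le (hle n)).mp (hFa _ (hpos n) (hle n)).1
    · filter_upwards [(hlim.comp hseq').eventually_le_const (lt_add_one _)] with n hn
      rw [Function.comp, intervalIntegral.integral_of_le (hle n)] at hn
      simpa only [Real.norm_eq_abs, abs_of_nonneg (hF0 _)] using hn
  have hmain : (∫ t in (0:ℝ)..1, q t) = ∫ t in (0:ℝ)..1, F t :=
    tendsto_nhds_unique hlim (hprim F hFint)
  refine ⟨hmain, ?_, ?_⟩
  · rw [hmain]
    exact intervalIntegral.integral_nonneg zero_le_one fun t _ => hF0 t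
  intro _ hQ0
  rw [hmain, intervalIntegral.integral_eq_zero_iff_of_le_of_nonneg_ae zero_le_one
    (Eventually.of_forall hF0) hFint] at hQ0
  have hode : ∀ᵐ t, t ∈ Ioc (0:ℝ) 1 → v' t = B t *ᵥ u t := by
    have h := (ae_restrict_iff' measurableSet_Ioc).mp hQ0
    filter_upwards [h] with t ht ht'
    have := dotProduct_self_eq_zero.mp (ht ht')
    exact sub_eq_zero.mp this
  intro t ht
  rw [huv t ht]
  rcases ht.1.eq_or_lt with h0 | h0
  · rw [← h0]; ext i; simp [hu]
  -- Gronwall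
  have hBb : ∀ i j, ∃ C, ∀ s ∈ Icc t 1, ‖B s i j‖ ≤ C := fun i j =>
    isCompact_Icc.exists_bound_of_continuousOn ((hBcont i j).mono (hsub t h0))
  choose C hC using hBb
  have hM : ∀ s ∈ Icc t 1, ∀ i j, |B s i j| ≤ ∑ i, ∑ j, |C i j| := by
    intro s hs i j
    refine (hC i j s hs).trans ((le_abs_self _).trans ?_)
    refine le_trans ?_ (Finset.single_le_sum (f := fun i => ∑ j, |C i j|)
      (fun _ _ => by positivity) (Finset.mem_univ i))
    exact (Finset.single_le_sum (f := fun j => |C i j|)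
      (fun _ _ => by positivity) (Finset.mem_univ j))
  set K : ℝ := 2 * ((∑ i, ∑ j, |C i j|) * d) with hK
  set G : ℝ → ℝ := fun s => Real.exp (K * s) * ∑ i, u s i * u s i with hG
  have hGac : AbsolutelyContinuousOnInterval G t 1 := by
    refine AbsolutelyContinuousOnInterval.fun_mul ?_ (ac_sum _ _ _ _ fun i _ =>
      (huac' t h0 ht.2 i).fun_mul (huac' t h0 ht.2 i))
    refine ContDiffOn.absolutelyContinuousOnInterval ?_
    fun_prop
  have hGi := hGac.integral_deriv_eq_sub
  have hGnn : 0 ≤ ∫ s in t..1, deriv G s := by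
    refine intervalIntegral.integral_nonneg_of_ae_restrict ht.2 ?_
    refine (ae_restrict_iff' measurableSet_Icc).mpr ?_
    filter_upwards [huder, hode] with s hs1 hs2 hs
    have hd := hs1 ⟨h0.le.trans hs.1, hs.2⟩
    have hv' := hs2 (hsub t h0 hs)
    have h : HasDerivAt G (Real.exp (K * s) * (K * 1) * (∑ i, u s i * u s i)
        + Real.exp (K * s) * ∑ i, (v' s i * u s i + u s i * v' s i)) s :=
      (((hasDerivAt_id s).const_mul K).exp).fun_mul
        (HasDerivAt.fun_sum fun i _ => (hd i).fun_mul (hd i))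
    rw [h.deriv]
    have hb := rq_bound d _ (B s) (hM s hs) (u s)
    rw [← dot_expand, ← hv'] at hb
    have e1 : ∑ i, (v' s i * u s i + u s i * v' s i) = 2 * (u s ⬝ᵥ v' s) := by
      simp only [dotProduct, Finset.mul_sum]
      exact Finset.sum_congr rfl fun i _ => by ring
    have e2 : ∑ i, u s i ^ 2 = ∑ i, u s i * u s i := by simp only [sq]
    rw [e1, mul_one, mul_assoc, ← mul_add]
    rw [e2] at hb
    have := (abs_le.mp hb).1
    refine mul_nonneg (Real.exp_pos _).le ?_
    rw [hK]; linarith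
  rw [hGi] at hGnn
  have hG1 : G 1 = 0 := by simp [hG, hu1]
  rw [hG1] at hGnn
  have hle : Real.exp (K * t) * (u t ⬝ᵥ u t) ≤ 0 := by
    have : G t = Real.exp (K * t) * (u t ⬝ᵥ u t) := rfl
    linarith
  have h2 : u t ⬝ᵥ u t ≤ 0 := by
    by_contra hcon
    push Not at hcon
    exact absurd hle (not_le.mpr (mul_pos (Real.exp_pos _) hcon))
  have h3 : 0 ≤ u t ⬝ᵥ u t := Finset.sum_nonneg fun i _ => mul_self_nonneg _
  exact dotProduct_self_eq_zero.mp (le_antisymm h2 h3)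
end
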